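/- No triangle-local probability distribution P on (Fin 2)³ has support exactly equal to {(0,1,1),(1,0,0)}, i.e. there is no triangle-local P with P(0,1,1) > 0, P(1,0,0) > 0, and P(a,b,c) = 0 for all other triples. -/

import Mathlib

/-- `P` is a local probability distribution in the triangle network: the three
sources are finite independent hidden variables, processed by stochastic
response kernels at the three observers. -/
def IsTriangleLocal (P : Fin 2 → Fin 2 → Fin 2 → ℝ) : Prop :=
  ∃ (nα nβ nγ : ℕ)
    (pα : Fin nα → ℝ) (pβ : Fin nβ → ℝ) (pγ : Fin nγ → ℝ)
    (PA : Fin 2 → Fin nβ → Fin nγ → ℝ)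
    (PB : Fin 2 → Fin nγ → Fin nα → ℝ)
    (PC : Fin 2 → Fin nα → Fin nβ → ℝ),
    (∀ α, 0 ≤ pα α) ∧ (∑ α, pα α) = 1 ∧
    (∀ β, 0 ≤ pβ β) ∧ (∑ β, pβ β) = 1 ∧
    (∀ γ, 0 ≤ pγ γ) ∧ (∑ γ, pγ γ) = 1 ∧
    (∀ a β γ, 0 ≤ PA a β γ) ∧ (∀ β γ, (∑ a, PA a β γ) = 1) ∧
    (∀ b γ α, 0 ≤ PB b γ α) ∧ (∀ γ α, (∑ b, PB b γ α) = 1) ∧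
    (∀ c α β, 0 ≤ PC c α β) ∧ (∀ α β, (∑ c, PC c α β) = 1) ∧
    (∀ a b c, P a b c =
      ∑ α, ∑ β, ∑ γ, pα α * pβ β * pγ γ * PA a β γ * PB b γ α * PC c α β)

/-- A stochastic response over a binary output has an outcome of positive probability. -/
lemma exists_pos_of_sum_eq_one {f : Fin 2 → ℝ} (h : ∑ i, f i = 1) : ∃ i, 0 < f i := by
  obtain ⟨i, -, hi⟩ := Finset.exists_lt_of_sum_lt (s := Finset.univ) (f := fun _ => (0 : ℝ))
    (g := f) (by simp [h])
  exact ⟨i, hi⟩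

/-- A positive sum of six-fold products of nonnegative factors has a term all of whose factors
are positive, and any such term makes the sum positive. -/
lemma sum_triangle_pos_iff {α β γ : Type*} [Fintype α] [Fintype β] [Fintype γ]
    {p : α → ℝ} {q : β → ℝ} {r : γ → ℝ} {u : β → γ → ℝ} {v : γ → α → ℝ} {w : α → β → ℝ}
    (hp : ∀ x, 0 ≤ p x) (hq : ∀ y, 0 ≤ q y) (hr : ∀ z, 0 ≤ r z)
    (hu : ∀ y z, 0 ≤ u y z) (hv : ∀ z x, 0 ≤ v z x) (hw : ∀ x y, 0 ≤ w x y) :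
    0 < ∑ x, ∑ y, ∑ z, p x * q y * r z * u y z * v z x * w x y ↔
      ∃ x y z, 0 < p x ∧ 0 < q y ∧ 0 < r z ∧ 0 < u y z ∧ 0 < v z x ∧ 0 < w x y := by
  have h0 : ∀ x y z, 0 ≤ p x * q y * r z * u y z * v z x * w x y := fun x y z =>
    mul_nonneg (mul_nonneg (mul_nonneg (mul_nonneg (mul_nonneg (hp x) (hq y)) (hr z))
      (hu y z)) (hv z x)) (hw x y)
  have h1 : ∀ x y, 0 ≤ ∑ z, p x * q y * r z * u y z * v z x * w x y := fun x y =>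
    Finset.sum_nonneg fun z _ => h0 x y z
  have h2 : ∀ x, 0 ≤ ∑ y, ∑ z, p x * q y * r z * u y z * v z x * w x y := fun x =>
    Finset.sum_nonneg fun y _ => h1 x y
  rw [Finset.sum_pos_iff_of_nonneg fun x _ => h2 x]
  simp only [Finset.sum_pos_iff_of_nonneg fun y _ => h1 _ y,
    Finset.sum_pos_iff_of_nonneg fun z _ => h0 _ _ z, Finset.mem_univ, true_and]
  refine exists_congr fun x => exists_congr fun y => exists_congr fun z => ⟨fun h => ?_, ?_⟩
  · have hne := h.ne'
    simp only [mul_ne_zero_iff] at hne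
    obtain ⟨⟨⟨⟨⟨hx, hy⟩, hz⟩, hyz⟩, hzx⟩, hxy⟩ := hne
    exact ⟨(hp x).lt_of_ne' hx, (hq y).lt_of_ne' hy, (hr z).lt_of_ne' hz,
      (hu y z).lt_of_ne' hyz, (hv z x).lt_of_ne' hzx, (hw x y).lt_of_ne' hxy⟩
  · rintro ⟨hx, hy, hz, hyz, hzx, hxy⟩
    positivity

/-- No triangle-local distribution has support exactly `{(0,1,1),(1,0,0)}`. -/
theorem no_triangle_local_P2 :
    ¬ ∃ P : Fin 2 → Fin 2 → Fin 2 → ℝ, IsTriangleLocal P ∧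
      ∀ a b c : Fin 2, (0 < P a b c ↔
        ((a, b, c) = ((0 : Fin 2), (1 : Fin 2), (1 : Fin 2)) ∨
         (a, b, c) = ((1 : Fin 2), (0 : Fin 2), (0 : Fin 2)))) := by
  rintro ⟨P, ⟨nα, nβ, nγ, pα, pβ, pγ, PA, PB, PC, hα, -, hβ, -, hγ, -, hA, sA, hB, sB, hC, sC,
    hP⟩, hsupp⟩
  have key : ∀ a b c, (∃ x y z, 0 < pα x ∧ 0 < pβ y ∧ 0 < pγ z ∧
      0 < PA a y z ∧ 0 < PB b z x ∧ 0 < PC c x y) ↔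
      ((a, b, c) = ((0 : Fin 2), (1 : Fin 2), (1 : Fin 2)) ∨
        (a, b, c) = ((1 : Fin 2), (0 : Fin 2), (0 : Fin 2))) := fun a b c => by
    rw [← hsupp, hP, sum_triangle_pos_iff hα hβ hγ (hA a) (hB b) (hC c)]
  obtain ⟨x₁, y₁, z₁, hx₁, -, hz₁, -, hB₁, -⟩ := (key 0 1 1).2 (Or.inl rfl)
  obtain ⟨x₂, y₂, z₂, hx₂, hy₂, -, -, -, hC₂⟩ := (key 1 0 0).2 (Or.inr rfl)
  obtain ⟨a, ha⟩ := exists_pos_of_sum_eq_one (sA y₂ z₁)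
  obtain ⟨c, hc⟩ := exists_pos_of_sum_eq_one (sC x₁ y₂)
  obtain ⟨b, hb⟩ := exists_pos_of_sum_eq_one (sB z₁ x₂)
  have h₁ := (key a 1 c).1 ⟨x₁, y₂, z₁, hx₁, hy₂, hz₁, ha, hB₁, hc⟩
  have h₂ := (key a b 0).1 ⟨x₂, y₂, z₁, hx₂, hy₂, hz₁, ha, hb, hC₂⟩
  simp only [Prod.mk.injEq] at h₁ h₂
  omega
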